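/- arXiv:2403.08421 — 2 statements merged into one kernel-verified Lean document; each statement's English description precedes it below -/
import Mathlib

section
/- An indicator R satisfies sharing proofness and non-manipulability if and only if R is the proportional indicator, i.e., R_i(N,S,p,C) = ((Σ_{s∈S} C_{is}) / (Σ_{j∈N} Σ_{s∈S} C_{js})) · σ for every platform (N,S,p,C) and every i ∈ N. -/
open Finset

/-- A streaming platform: a finite set `N` of services (`|N| ≥ 3`), a finite nonempty set `S`
of subscribers, positive subscription prices `p` on `S`, and a nonnegative consumption matrix
`C` whose columns (over `N`) have positive sum. -/
structure Platform where
  N : Finset ℕ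
  S : Finset ℕ
  p : ℕ → ℝ
  C : ℕ → ℕ → ℝ
  card_N : 3 ≤ N.card
  S_nonempty : S.Nonempty
  p_pos : ∀ s ∈ S, 0 < p s
  C_nonneg : ∀ i s, 0 ≤ C i s
  col_pos : ∀ s ∈ S, 0 < ∑ i ∈ N, C i s

/-- The success of the platform: total subscription revenue. -/
noncomputable def success (P : Platform) : ℝ := ∑ s ∈ P.S, P.p s

/-- `Ns P s` is the set of services consumed by subscriber `s`. -/
noncomputable def Ns (P : Platform) (s : ℕ) : Finset ℕ :=
  P.N.filter fun j => 0 < P.C j s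

/-- The uniform indicator. -/
noncomputable def RU (P : Platform) (_ : ℕ) : ℝ := success P / (P.N.card : ℝ)

/-- The subscriber-uniform indicator. -/
noncomputable def RSU (P : Platform) (i : ℕ) : ℝ :=
  ∑ s ∈ P.S.filter (fun s => i ∈ Ns P s), P.p s / ((Ns P s).card : ℝ)

/-- The proportional indicator. -/
noncomputable def RP (P : Platform) (i : ℕ) : ℝ :=
  ((∑ s ∈ P.S, P.C i s) / ∑ j ∈ P.N, ∑ s ∈ P.S, P.C j s) * success P

/-- The subscriber-proportional indicator. -/
noncomputable def RSP (P : Platform) (i : ℕ) : ℝ :=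
  ∑ s ∈ P.S, (P.C i s / ∑ j ∈ P.N, P.C j s) * P.p s

/-- An indicator assigns to each platform a vector of nonnegative reals on `N`
summing to the success of the platform. -/
def IsIndicator (R : Platform → ℕ → ℝ) : Prop :=
  ∀ P : Platform, (∀ i ∈ P.N, 0 ≤ R P i) ∧ (∑ i ∈ P.N, R P i = success P)

/-- CompositionAxiom: combining two disjoint subscriber populations adds the indicators. -/
def CompositionAxiom (R : Platform → ℕ → ℝ) : Prop :=
  ∀ P P' Q : Platform,
    P'.N = P.N → Q.N = P.N →
    Disjoint P.S P'.S →
    Q.S = P.S ∪ P'.S →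
    (∀ s ∈ P.S, Q.p s = P.p s) → (∀ s ∈ P'.S, Q.p s = P'.p s) →
    (∀ i ∈ P.N, ∀ s ∈ P.S, Q.C i s = P.C i s) →
    (∀ i ∈ P.N, ∀ s ∈ P'.S, Q.C i s = P'.C i s) →
    ∀ i ∈ P.N, R Q i = R P i + R P' i

/-- Non-manipulability: merging a group of services `N'` into a single service `i`
gives that service the total relevance of the group. -/
def NonManipulability (R : Platform → ℕ → ℝ) : Prop :=
  ∀ P Q : Platform, ∀ N' ⊆ P.N, N'.Nonempty → ∀ i ∈ N',
    Q.N = insert i (P.N \ N') →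
    Q.S = P.S →
    (∀ s ∈ P.S, Q.p s = P.p s) →
    (∀ s ∈ P.S, Q.C i s = ∑ j ∈ N', P.C j s) →
    (∀ j ∈ P.N \ N', ∀ s ∈ P.S, Q.C j s = P.C j s) →
    R Q i = ∑ j ∈ N', R P j

/-- Sharing proofness: merging a group of subscribers `S'` into a single subscriber `s`
(adding their prices and consumptions) leaves the indicator unchanged. -/
def SharingProofness (R : Platform → ℕ → ℝ) : Prop :=
  ∀ P Q : Platform, ∀ S' ⊆ P.S, S'.Nonempty → ∀ s ∈ S',
    Q.N = P.N →
    Q.S = insert s (P.S \ S') →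
    Q.p s = ∑ t ∈ S', P.p t →
    (∀ t ∈ P.S \ S', Q.p t = P.p t) →
    (∀ i ∈ P.N, Q.C i s = ∑ t ∈ S', P.C i t) →
    (∀ i ∈ P.N, ∀ t ∈ P.S \ S', Q.C i t = P.C i t) →
    ∀ i ∈ P.N, R Q i = R P i

/-- Symmetry: services with identical consumption get the same relevance. -/
def Symmetry (R : Platform → ℕ → ℝ) : Prop :=
  ∀ P : Platform, ∀ i ∈ P.N, ∀ j ∈ P.N,
    (∀ s ∈ P.S, P.C i s = P.C j s) → R P i = R P j

/-- Strong symmetry: services consumed by exactly the same subscribers get the same relevance. -/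
def StrongSymmetry (R : Platform → ℕ → ℝ) : Prop :=
  ∀ P : Platform, ∀ i ∈ P.N, ∀ j ∈ P.N,
    (∀ s ∈ P.S, 0 < P.C i s ↔ 0 < P.C j s) → R P i = R P j

/-- Nullity: a service consumed by nobody gets zero relevance. -/
def Nullity (R : Platform → ℕ → ℝ) : Prop :=
  ∀ P : Platform, ∀ i ∈ P.N, (∀ s ∈ P.S, P.C i s = 0) → R P i = 0

/-- Homogeneity: rescaling the consumption matrix by a positive constant leaves the
indicator unchanged. -/
def Homogeneity (R : Platform → ℕ → ℝ) : Prop :=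
  ∀ P Q : Platform, ∀ lam : ℝ, 0 < lam →
    Q.N = P.N → Q.S = P.S →
    (∀ s ∈ P.S, Q.p s = P.p s) →
    (∀ i ∈ P.N, ∀ s ∈ P.S, Q.C i s = lam * P.C i s) →
    ∀ i ∈ P.N, R Q i = R P i

/-- Consumption sensitivity: for fixed `N`, `S`, `p`, if two sequences of admissible
consumption matrices become arbitrarily close (in ℓ¹), so do the corresponding indicators. -/
def ConsumptionSensitivity (R : Platform → ℕ → ℝ) : Prop :=
  ∀ (P Q : ℕ → Platform) (N S : Finset ℕ) (p : ℕ → ℝ),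
    (∀ n, (P n).N = N) → (∀ n, (Q n).N = N) →
    (∀ n, (P n).S = S) → (∀ n, (Q n).S = S) →
    (∀ n, ∀ s ∈ S, (P n).p s = p s) → (∀ n, ∀ s ∈ S, (Q n).p s = p s) →
    Filter.Tendsto (fun n => ∑ i ∈ N, ∑ s ∈ S, |(P n).C i s - (Q n).C i s|)
      Filter.atTop (nhds 0) →
    Filter.Tendsto (fun n => ∑ i ∈ N, |R (P n) i - R (Q n) i|)
      Filter.atTop (nhds 0)

/-- Replace entry `(i, s)` of the matrix `C` by `x`. -/
noncomputable def upd (C : ℕ → ℕ → ℝ) (i s : ℕ) (x : ℝ) : ℕ → ℕ → ℝ :=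
  fun j t => if j = i ∧ t = s then x else C j t

theorem sum_insert_sdiff_eq {f g : ℕ → ℝ} {A B : Finset ℕ} {i : ℕ} (hB : B ⊆ A) (hi : i ∈ B)
    (h₁ : f i = ∑ j ∈ B, g j) (h₂ : ∀ j ∈ A \ B, f j = g j) :
    ∑ j ∈ insert i (A \ B), f j = ∑ j ∈ A, g j := by
  rw [sum_insert (by simp [hi]), h₁, sum_congr rfl h₂, add_comm, sum_sdiff hB]

/-- A nonnegative function on `[0, T]` that is additive there is linear. -/
theorem eq_mul_div_of_additive_on_Icc {g : ℝ → ℝ} {T : ℝ} (hT : 0 < T)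
    (hg : ∀ x, 0 ≤ x → x ≤ T → 0 ≤ g x)
    (hadd : ∀ x y, 0 ≤ x → 0 ≤ y → x + y ≤ T → g x + g y = g (x + y))
    {x : ℝ} (hx : 0 ≤ x) (hxT : x ≤ T) : g x = x / T * g T := by
  have hgT : 0 ≤ g T := hg T hT.le le_rfl
  have key : ∀ n : ℕ, ∀ x, 0 ≤ x → x ≤ T → |g x - x / T * g T| ≤ g T * (1 / 2) ^ n := by
    intro n
    induction n with
    | zero =>
      intro x hx hxT
      have h₁ : g x + g (T - x) = g T := by
        simpa using hadd x (T - x) hx (by linarith) (by linarith)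
      have h₂ := hg x hx hxT
      have h₃ := hg (T - x) (by linarith) (by linarith)
      have h₄ : 0 ≤ x / T := by positivity
      have h₅ : x / T ≤ 1 := (div_le_one hT).2 hxT
      rw [abs_le]
      constructor <;> nlinarith
    | succ n ih =>
      have low : ∀ x, 0 ≤ x → x + x ≤ T → |g x - x / T * g T| ≤ g T * (1 / 2) ^ (n + 1) := by
        intro x hx hxT
        have h₁ := hadd x x hx hx hxT
        have h₂ := ih (x + x) (by linarith) hxT
        rw [← h₁, show g x + g x - (x + x) / T * g T = 2 * (g x - x / T * g T) by ring,
          abs_mul, abs_two] at h₂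
        rw [pow_succ]
        linarith
      intro x hx hxT
      rcases le_total (x + x) T with h | h
      · exact low x hx h
      · have h₁ : g x + g (T - x) = g T := by
          simpa using hadd x (T - x) hx (by linarith) (by linarith)
        have h₂ := low (T - x) (by linarith) (by linarith)
        have h₃ : g (T - x) - (T - x) / T * g T = -(g x - x / T * g T) := by
          rw [← h₁]
          field_simp
          ring
        rwa [h₃, abs_neg] at h₂
  have hlim : Filter.Tendsto (fun n : ℕ => g T * (1 / 2 : ℝ) ^ n) Filter.atTop (nhds 0) := by
    simpa using (tendsto_pow_atTop_nhds_zero_of_lt_one (r := (1 / 2 : ℝ))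
      (by norm_num) (by norm_num)).const_mul (g T)
  have h₀ : |g x - x / T * g T| ≤ 0 := ge_of_tendsto' hlim fun n => key n x hx hxT
  linarith [abs_nonpos_iff.1 h₀]

/-- Admissible data for a platform with a single subscriber consuming according to `c`. -/
structure Admissible (N : Finset ℕ) (c : ℕ → ℝ) : Prop where
  card : 3 ≤ N.card
  nonneg : ∀ i, 0 ≤ c i
  pos : 0 < ∑ i ∈ N, c i

/-- `F` divides the amount `σ` among the services, compatibly with mergers of services. -/
structure IsMergeRule (σ : ℝ) (F : Finset ℕ → (ℕ → ℝ) → ℕ → ℝ) : Prop where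
  nonneg : ∀ {N c}, Admissible N c → ∀ i ∈ N, 0 ≤ F N c i
  sum : ∀ {N c}, Admissible N c → ∑ i ∈ N, F N c i = σ
  merge : ∀ {N c N' M d i}, Admissible N c → Admissible M d → N' ⊆ N → i ∈ N' →
    M = insert i (N \ N') → d i = ∑ j ∈ N', c j → (∀ j ∈ N \ N', d j = c j) →
    F M d i = ∑ j ∈ N', F N c j

theorem Admissible.merge {N N' : Finset ℕ} {c : ℕ → ℝ} {i : ℕ} (h : Admissible N c)
    (hN' : N' ⊆ N) (hi : i ∈ N') (hcard : N'.card + 2 ≤ N.card) :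
    Admissible (insert i (N \ N')) (Function.update c i (∑ j ∈ N', c j)) where
  card := by
    rw [card_insert_of_notMem (by simp [hi]), card_sdiff_of_subset hN']
    omega
  nonneg k := by
    by_cases hk : k = i
    · subst hk
      simpa using sum_nonneg fun j _ => h.nonneg j
    · simpa [hk] using h.nonneg k
  pos := by
    rw [sum_insert_sdiff_eq (g := c) hN' hi (by simp)]
    · exact h.pos
    · intro j hj
      have : j ≠ i := by rintro rfl; simp [hi] at hj
      simp [this]

namespace IsMergeRule

variable {σ : ℝ} {F : Finset ℕ → (ℕ → ℝ) → ℕ → ℝ} {N N' : Finset ℕ} {c d : ℕ → ℝ} {i j : ℕ}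

theorem congr (hF : IsMergeRule σ F) (hc : Admissible N c) (hd : Admissible N d)
    (h : ∀ k ∈ N, d k = c k) (hi : i ∈ N) : F N d i = F N c i := by
  have := hF.merge (N' := {i}) (i := i) hc hd (by simpa) (by simp)
    (by ext k; by_cases hk : k = i <;> simp [hk, hi]) (by simp [h i hi])
    (fun j hj => h j (mem_sdiff.1 hj).1)
  simpa using this

theorem merge_update (hF : IsMergeRule σ F) (hc : Admissible N c) (hN' : N' ⊆ N) (hi : i ∈ N')
    (hcard : N'.card + 2 ≤ N.card) :
    F (insert i (N \ N')) (Function.update c i (∑ j ∈ N', c j)) i = ∑ j ∈ N', F N c j := by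
  refine hF.merge hc (hc.merge hN' hi hcard) hN' hi rfl (by simp) fun j hj => ?_
  have : j ≠ i := by rintro rfl; simp [hi] at hj
  simp [this]

/-- A service outside a merger keeps its value. -/
theorem merge_update_of_notMem (hF : IsMergeRule σ F) (hc : Admissible N c) (hN' : N' ⊆ N)
    (hi : i ∈ N') (hcard : N'.card + 3 ≤ N.card) (hj : j ∈ N) (hj' : j ∉ N') :
    F (insert i (N \ N')) (Function.update c i (∑ j ∈ N', c j)) j = F N c j := by
  have hij : i ≠ j := by rintro rfl; exact hj' hi
  have hc₂ := hc.merge hN' hi (by omega)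
  have h₁ := hF.merge_update hc (i := j) (N' := insert j N')
    (insert_subset hj hN') (by simp) (by rw [card_insert_of_notMem hj']; omega)
  have hc₃ := hc.merge (i := j) (N' := insert j N')
    (insert_subset hj hN') (by simp) (by rw [card_insert_of_notMem hj']; omega)
  have h₂ := hF.merge (N' := {j, i}) (i := j) hc₂ hc₃
    (by intro k; simp only [mem_insert, mem_singleton, mem_sdiff]
        rintro (rfl | rfl) <;> simp [hj, hj']) (by simp)
    (by ext k
        by_cases hk : k = j
        · simp [hk]
        · by_cases hk' : k = i
          · simp [hk', hij, hi]
          · simp [hk, hk'])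
    (by simp [sum_pair hij.symm, sum_insert hj', Function.update_of_ne hij.symm])
    (by intro k hk
        simp only [mem_sdiff, mem_insert, mem_singleton, not_or] at hk
        simp [hk.2.1, hk.2.2])
  rw [h₂, sum_pair hij.symm, sum_insert hj', hF.merge_update hc hN' hi (by omega)] at h₁
  linarith

theorem sum_eq_sum (hF : IsMergeRule σ F) (hc : Admissible N c) (hd : Admissible N d)
    (hN' : N' ⊆ N) (hi : i ∈ N') (hcard : N'.card + 2 ≤ N.card)
    (hsum : ∑ k ∈ N', c k = ∑ k ∈ N', d k) (h : ∀ k ∈ N \ N', c k = d k) :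
    ∑ k ∈ N', F N c k = ∑ k ∈ N', F N d k := by
  rw [← hF.merge_update hc hN' hi hcard]
  refine hF.merge hd (hc.merge hN' hi hcard) hN' hi rfl (by simp [hsum]) fun k hk => ?_
  have : k ≠ i := by rintro rfl; simp [hi] at hk
  simp [this, h k hk]

theorem eq_of_transfer (hF : IsMergeRule σ F) (hc : Admissible N c) (hd : Admissible N d)
    (hN' : N' ⊆ N) (hi : i ∈ N') (hcard : N'.card + 3 ≤ N.card)
    (hsum : ∑ k ∈ N', c k = ∑ k ∈ N', d k) (h : ∀ k ∈ N \ N', c k = d k)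
    (hj : j ∈ N) (hj' : j ∉ N') : F N c j = F N d j := by
  rw [← hF.merge_update_of_notMem hc hN' hi hcard hj hj',
    ← hF.merge_update_of_notMem hd hN' hi hcard hj hj']
  refine hF.congr (hd.merge hN' hi (by omega)) (hc.merge hN' hi (by omega)) ?_ (by simp [hj, hj'])
  intro k hk
  rcases mem_insert.1 hk with rfl | hkN
  · simp [hsum]
  · have : k ≠ i := by rintro rfl; exact (mem_sdiff.1 hkN).2 hi
    simp [this, h k hkN]

theorem eq_zero_of_eq_zero (hF : IsMergeRule σ F) (hc : Admissible N c) (hN : 5 ≤ N.card)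
    (hj : j ∈ N) (h : c j = 0) : F N c j = 0 := by
  obtain ⟨e, he, hej⟩ := exists_mem_ne (by omega : 1 < N.card) j
  obtain ⟨b, hb⟩ : (N \ {j, e}).Nonempty := by
    rw [← card_pos]
    have := le_card_sdiff {j, e} N
    have := card_le_two (a := j) (b := e)
    omega
  simp only [mem_sdiff, mem_insert, mem_singleton, not_or] at hb
  obtain ⟨hb, hbj, hbe⟩ := hb
  have erase : ∀ a ∈ N, a ≠ j → insert a (N \ {j, a}) = N.erase j := by
    intro a ha haj
    ext k
    by_cases hk : k = a
    · simp [hk, ha, haj]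
    · simp [hk, and_comm]
  have upd : ∀ a, a ≠ j → Function.update c a (∑ k ∈ {j, a}, c k) = c := by
    intro a haj
    simp [sum_pair haj.symm, h]
  have h₁ := hF.merge_update hc (N' := {j, e}) (i := e) (by simp [insert_subset_iff, hj, he])
    (by simp) (by rw [card_pair hej.symm]; omega)
  have h₂ := hF.merge_update_of_notMem hc (N' := {j, b}) (i := b) (j := e)
    (by simp [insert_subset_iff, hj, hb])
    (by simp) (by rw [card_pair (Ne.symm hbj)]; omega) he (by simp [hej, Ne.symm hbe])
  rw [erase e he hej, upd e hej, sum_pair hej.symm] at h₁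
  rw [erase b hb hbj, upd b hbj] at h₂
  linarith

/-- Moving to `w` the consumption of the services in `A` does not affect the other services. -/
theorem eq_of_collapse (hF : IsMergeRule σ F) (hc : Admissible N c) (hN : 5 ≤ N.card)
    {w : ℕ} (hw : w ∈ N) (hi : i ∈ N) (hiw : i ≠ w) (A : Finset ℕ) (hA : A ⊆ N) (hiA : i ∉ A)
    (hwA : w ∉ A) :
    Admissible N (fun k => if k ∈ A then 0 else if k = w then c w + ∑ a ∈ A, c a else c k) ∧
      F N (fun k => if k ∈ A then 0 else if k = w then c w + ∑ a ∈ A, c a else c k) i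
        = F N c i := by
  induction A using Finset.induction_on with
  | empty =>
    have : (fun k => if k = w then c w else c k) = c := by
      ext k
      split_ifs with hk
      · rw [hk]
      · rfl
    simp [this, hc]
  | insert a A ha ih =>
    simp only [mem_insert, not_or] at hiA hwA
    obtain ⟨ihc, ihF⟩ := ih ((subset_insert _ _).trans hA) hiA.2 hwA.2
    have haN : a ∈ N := hA (by simp)
    have haw : a ≠ w := Ne.symm hwA.1
    have hsub : ({a, w} : Finset ℕ) ⊆ N := by simp [insert_subset_iff, haN, hw]
    set d : ℕ → ℝ := fun k => if k ∈ A then 0 else if k = w then c w + ∑ a ∈ A, c a else c k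
      with hd
    set e : ℕ → ℝ := fun k => if k ∈ insert a A then 0
      else if k = w then c w + ∑ a ∈ insert a A, c a else c k with he
    have hsum : ∑ k ∈ {a, w}, e k = ∑ k ∈ {a, w}, d k := by
      simp [hd, he, sum_pair haw, ha, haw, hwA.1, hwA.2, sum_insert ha]
      ring
    have hout : ∀ k ∈ N \ {a, w}, e k = d k := by
      intro k hk
      simp only [mem_sdiff, mem_insert, mem_singleton, not_or] at hk
      simp [hd, he, hk.2.1, hk.2.2]
    have hadm : Admissible N e := by
      refine ⟨hc.card, fun k => ?_, ?_⟩
      · have := hc.nonneg w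
        have := hc.nonneg k
        have := sum_nonneg (s := insert a A) fun j _ => hc.nonneg j
        simp only [he]
        split_ifs <;> linarith
      · rw [← sum_sdiff hsub, hsum, sum_congr rfl hout, sum_sdiff hsub]
        exact ihc.pos
    refine ⟨hadm, ?_⟩
    rw [← ihF]
    exact hF.eq_of_transfer hadm ihc hsub (i := a) (by simp) (by rw [card_pair haw]; omega) hsum
      hout hi (by simp [hiA.1, hiw])

/-- The value of a service depends only on its consumption and on the total consumption. -/
theorem eq_of_eq (hF : IsMergeRule σ F) (hc : Admissible N c) (hd : Admissible N d)
    (hN : 5 ≤ N.card) (hi : i ∈ N) (h : c i = d i) (hsum : ∑ k ∈ N, c k = ∑ k ∈ N, d k) :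
    F N c i = F N d i := by
  obtain ⟨w, hw, hwi⟩ := exists_mem_ne (by omega : 1 < N.card) i
  have hA : (N.erase i).erase w ⊆ N := (erase_subset _ _).trans (erase_subset _ _)
  obtain ⟨h₁, h₂⟩ := hF.eq_of_collapse hc hN hw hi hwi.symm _ hA (by simp) (by simp)
  obtain ⟨h₃, h₄⟩ := hF.eq_of_collapse hd hN hw hi hwi.symm _ hA (by simp) (by simp)
  rw [← h₂, ← h₄]
  refine hF.congr h₃ h₁ (fun k hk => ?_) hi
  by_cases hki : k = i
  · simp [hki, hwi.symm, h]
  by_cases hkw : k = w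
  · have hwm : w ∈ N.erase i := by simp [hw, hwi]
    simp only [hkw, mem_erase, ne_eq, not_true_eq_false, false_and, if_false, if_true]
    rw [add_sum_erase _ _ hwm, add_sum_erase _ _ hwm]
    rw [← add_sum_erase _ _ hi, ← add_sum_erase N d hi] at hsum
    linarith
  · simp [hki, hkw, hk]

theorem eq_proportional_of_five_le (hF : IsMergeRule σ F) (hc : Admissible N c)
    (hN : 5 ≤ N.card) (hi : i ∈ N) : F N c i = c i / (∑ k ∈ N, c k) * σ := by
  obtain ⟨j, hj, hji⟩ := exists_mem_ne (by omega : 1 < N.card) i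
  obtain ⟨w, hw⟩ : (N \ {i, j}).Nonempty := by
    rw [← card_pos]
    have := le_card_sdiff {i, j} N
    have := card_le_two (a := i) (b := j)
    omega
  simp only [mem_sdiff, mem_insert, mem_singleton, not_or] at hw
  obtain ⟨hw, hwi, hwj⟩ := hw
  set T := ∑ k ∈ N, c k with hT
  have hTpos : 0 < T := hc.pos
  let v : ℝ → ℝ → ℕ → ℝ := fun x y k =>
    (if k = i then x else 0) + (if k = j then y else 0) + (if k = w then T - x - y else 0)
  have hvsum : ∀ x y, ∑ k ∈ N, v x y k = T := by
    intro x y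
    simp only [v, sum_add_distrib, sum_ite_eq', hi, hj, hw, if_true]
    ring
  have hv : ∀ x y, 0 ≤ x → 0 ≤ y → x + y ≤ T → Admissible N (v x y) := by
    intro x y hx hy hxy
    refine ⟨hc.card, fun k => ?_, by rw [hvsum]; exact hTpos⟩
    simp only [v]
    split_ifs <;> linarith
  have hvi : ∀ x y, v x y i = x := by intro x y; simp [v, Ne.symm hji, Ne.symm hwi]
  have hvj : ∀ x y, v x y j = y := by intro x y; simp [v, hji, Ne.symm hwj]
  have pair : ∀ x y, 0 ≤ x → 0 ≤ y → x + y ≤ T →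
      F N (v x y) i + F N (v x y) j = F N (v (x + y) 0) i := by
    intro x y hx hy hxy
    have h₁ := hv x y hx hy hxy
    have h₂ := hv (x + y) 0 (by linarith) le_rfl (by linarith)
    have h := hF.sum_eq_sum h₁ h₂ (N' := {i, j}) (i := i) (by simp [insert_subset_iff, hi, hj])
      (by simp) (by rw [card_pair hji.symm]; omega)
      (by rw [sum_pair hji.symm, sum_pair hji.symm]; simp [hvi, hvj])
      (by intro k hk
          simp only [mem_sdiff, mem_insert, mem_singleton, not_or] at hk
          simp only [v, hk.2.1, hk.2.2, if_false]
          split_ifs <;> ring)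
    rw [sum_pair hji.symm, sum_pair hji.symm, hF.eq_zero_of_eq_zero h₂ hN hj (hvj _ _),
      add_zero] at h
    exact h
  have swap : ∀ y, 0 ≤ y → y ≤ T → F N (v 0 y) j = F N (v y 0) i := by
    intro y hy hyT
    have h := pair 0 y le_rfl hy (by linarith)
    rwa [hF.eq_zero_of_eq_zero (hv 0 y le_rfl hy (by linarith)) hN hi (hvi _ _), zero_add,
      zero_add] at h
  have hlin := eq_mul_div_of_additive_on_Icc (g := fun x => F N (v x 0) i) hTpos
    (fun x hx hxT => hF.nonneg (hv x 0 hx le_rfl (by linarith)) i hi)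
    (fun x y hx hy hxy => by
      have hvxy := hv x y hx hy hxy
      have h₁ := hF.eq_of_eq (hv x 0 hx le_rfl (by linarith)) hvxy hN hi
        (by rw [hvi, hvi]) (by rw [hvsum, hvsum])
      have h₂ := hF.eq_of_eq (hv 0 y le_rfl hy (by linarith)) hvxy hN hj
        (by rw [hvj, hvj]) (by rw [hvsum, hvsum])
      rw [swap y hy (by linarith)] at h₂
      simp only [h₁, h₂, pair x y hx hy hxy])
    (hc.nonneg i) (single_le_sum (fun k _ => hc.nonneg k) hi)
  have hci : c i ≤ T := single_le_sum (fun k _ => hc.nonneg k) hi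
  have hvT := hv T 0 hTpos.le le_rfl (by linarith)
  have htop : F N (v T 0) i = σ := by
    rw [← hF.sum hvT, sum_eq_single i]
    · intro k hk hki
      exact hF.eq_zero_of_eq_zero hvT hN hk (by simp [v, hki])
    · exact fun h => absurd hi h
  rw [hF.eq_of_eq hc (hv (c i) 0 (hc.nonneg i) le_rfl (by linarith)) hN hi (hvi _ _).symm
    (hvsum _ _).symm]
  simpa only [htop] using hlin

theorem eq_proportional (hF : IsMergeRule σ F) (hc : Admissible N c) (hi : i ∈ N) :
    F N c i = c i / (∑ k ∈ N, c k) * σ := by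
  obtain ⟨a, ha⟩ := Infinite.exists_notMem_finset N
  obtain ⟨b, hb⟩ := Infinite.exists_notMem_finset (insert a N)
  simp only [mem_insert, not_or] at hb
  obtain ⟨hba, hb⟩ := hb
  have hia : i ≠ a := by rintro rfl; exact ha hi
  have hib : i ≠ b := by rintro rfl; exact hb hi
  set M := insert b (insert a N) with hM
  set d : ℕ → ℝ := fun k => if k ∈ N then c k else 0 with hd
  have hMcard : M.card = N.card + 2 := by
    rw [hM, card_insert_of_notMem (by simp [hba, hb]), card_insert_of_notMem ha]
  have hsum : ∑ k ∈ M, d k = ∑ k ∈ N, c k := by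
    rw [hM, sum_insert (by simp [hba, hb]), sum_insert ha]
    simp only [hd, ha, hb, if_false, zero_add]
    exact sum_congr rfl fun k hk => by simp [hk]
  have hadm : Admissible M d := by
    refine ⟨by have := hc.card; omega, fun k => ?_, by rw [hsum]; exact hc.pos⟩
    have := hc.nonneg k
    simp only [hd]
    split_ifs <;> linarith
  have h5 : 5 ≤ M.card := by have := hc.card; omega
  have h := hF.merge hadm hc (N' := {i, a, b}) (i := i)
    (by simp [insert_subset_iff, hM, hi]) (by simp)
    (by ext k
        by_cases hki : k = i
        · simp [hki, hi]
        by_cases hka : k = a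
        · simp [hka, ha, hia.symm]
        by_cases hkb : k = b
        · simp [hkb, hb, hib.symm]
        simp [hM, hki, hka, hkb])
    (by rw [sum_insert (by simp [hia, hib]), sum_pair (Ne.symm hba)]; simp [hd, hi, ha, hb])
    (by intro k hk
        simp only [hM, mem_sdiff, mem_insert, mem_singleton, not_or] at hk
        have : k ∈ N := by tauto
        simp [hd, this])
  rw [h, sum_insert (by simp [hia, hib]), sum_pair (Ne.symm hba),
    hF.eq_zero_of_eq_zero (j := a) hadm h5 (by simp [hM]) (by simp [hd, ha]),
    hF.eq_zero_of_eq_zero (j := b) hadm h5 (by simp [hM]) (by simp [hd, hb]),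
    hF.eq_proportional_of_five_le hadm h5 (by simp [hM, hi]), hsum]
  simp [hd, hi]

end IsMergeRule

/-- The platform with the single subscriber `s`, price `σ` and consumption vector `c`. -/
def Platform.single (s : ℕ) {σ : ℝ} (hσ : 0 < σ) {N : Finset ℕ} {c : ℕ → ℝ}
    (h : Admissible N c) : Platform where
  N := N
  S := {s}
  p _ := σ
  C i _ := c i
  card_N := h.card
  S_nonempty := singleton_nonempty s
  p_pos _ _ := hσ
  C_nonneg i _ := h.nonneg i
  col_pos _ _ := h.pos

open Classical in
theorem isMergeRule_single {R : Platform → ℕ → ℝ} (hR : IsIndicator R)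
    (hM : NonManipulability R) (s : ℕ) {σ : ℝ} (hσ : 0 < σ) :
    IsMergeRule σ fun N c i =>
      if h : Admissible N c then R (Platform.single s hσ h) i else 0 where
  nonneg h i hi := by
    simpa [h] using (hR (Platform.single s hσ h)).1 i hi
  sum h := by
    simpa [h, success, Platform.single] using (hR (Platform.single s hσ h)).2
  merge {N c N' M d i} h h' hN' hi hMN hdi hd := by
    simpa [h, h'] using hM (Platform.single s hσ h) (Platform.single s hσ h') N' hN' ⟨i, hi⟩ i hi
      hMN rfl (fun _ _ => rfl) (fun _ _ => hdi) (fun j hj _ _ => hd j hj)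

theorem success_pos (P : Platform) : 0 < success P := sum_pos P.p_pos P.S_nonempty

theorem Platform.admissible (P : Platform) : Admissible P.N fun i => ∑ s ∈ P.S, P.C i s where
  card := P.card_N
  nonneg i := sum_nonneg fun s _ => P.C_nonneg i s
  pos := by
    rw [sum_comm]
    exact sum_pos P.col_pos P.S_nonempty

theorem eq_RP_of_sharingProofness_of_nonManipulability {R : Platform → ℕ → ℝ}
    (hR : IsIndicator R) (hS : SharingProofness R) (hM : NonManipulability R) (P : Platform)
    {i : ℕ} (hi : i ∈ P.N) : R P i = RP P i := by
  obtain ⟨s, hs⟩ := P.S_nonempty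
  have h := (isMergeRule_single hR hM s (success_pos P)).eq_proportional P.admissible hi
  rw [dif_pos P.admissible] at h
  rw [RP, ← h]
  exact (hS P (Platform.single s (success_pos P) P.admissible) P.S Subset.rfl ⟨s, hs⟩ s hs rfl
    (by simp [Platform.single]) rfl (by simp) (fun _ _ => rfl) (by simp) i hi).symm

theorem sharingProofness_RP {P Q : Platform} {S' : Finset ℕ} (hS' : S' ⊆ P.S) {s : ℕ}
    (hs : s ∈ S') (hN : Q.N = P.N) (hS : Q.S = insert s (P.S \ S'))
    (hp : Q.p s = ∑ t ∈ S', P.p t) (hp' : ∀ t ∈ P.S \ S', Q.p t = P.p t)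
    (hC : ∀ i ∈ P.N, Q.C i s = ∑ t ∈ S', P.C i t)
    (hC' : ∀ i ∈ P.N, ∀ t ∈ P.S \ S', Q.C i t = P.C i t) {i : ℕ} (hi : i ∈ P.N) :
    RP Q i = RP P i := by
  have hsum : ∀ j ∈ P.N, ∑ t ∈ Q.S, Q.C j t = ∑ t ∈ P.S, P.C j t := fun j hj => by
    rw [hS, sum_insert_sdiff_eq hS' hs (hC j hj) (hC' j hj)]
  have hsuccess : success Q = success P := by
    rw [success, success, hS, sum_insert_sdiff_eq hS' hs hp hp']
  rw [RP, RP, hsuccess, hsum i hi, hN, sum_congr rfl hsum]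

theorem nonManipulability_RP {P Q : Platform} {N' : Finset ℕ} (hN' : N' ⊆ P.N) {i : ℕ}
    (hi : i ∈ N') (hN : Q.N = insert i (P.N \ N')) (hS : Q.S = P.S)
    (hp : ∀ s ∈ P.S, Q.p s = P.p s) (hC : ∀ s ∈ P.S, Q.C i s = ∑ j ∈ N', P.C j s)
    (hC' : ∀ j ∈ P.N \ N', ∀ s ∈ P.S, Q.C j s = P.C j s) :
    RP Q i = ∑ j ∈ N', RP P j := by
  have hQi : ∑ s ∈ Q.S, Q.C i s = ∑ j ∈ N', ∑ s ∈ P.S, P.C j s := by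
    rw [hS, sum_congr rfl hC, sum_comm]
  have htotal : ∑ j ∈ Q.N, ∑ s ∈ Q.S, Q.C j s = ∑ j ∈ P.N, ∑ s ∈ P.S, P.C j s := by
    rw [hN, sum_insert_sdiff_eq hN' hi hQi fun j hj => ?_]
    rw [hS, sum_congr rfl (hC' j hj)]
  have hsuccess : success Q = success P := by
    rw [success, success, hS, sum_congr rfl hp]
  simp only [RP]
  rw [htotal, hsuccess, hQi, sum_div, sum_mul]

/-- An indicator satisfies sharing proofness and non-manipulability if and only if it is the
proportional indicator. -/
theorem proportional_characterization (R : Platform → ℕ → ℝ) (hR : IsIndicator R) :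
    (SharingProofness R ∧ NonManipulability R) ↔ (∀ P : Platform, ∀ i ∈ P.N, R P i = RP P i) := by
  constructor
  · rintro ⟨hS, hM⟩ P i hi
    exact eq_RP_of_sharingProofness_of_nonManipulability hR hS hM P hi
  · intro h
    refine ⟨?_, ?_⟩
    · intro P Q S' hS' _ s hs hN hS hp hp' hC hC' i hi
      rw [h P i hi, h Q i (hN ▸ hi)]
      exact sharingProofness_RP hS' hs hN hS hp hp' hC hC' hi
    · intro P Q N' hN' _ i hi hN hS hp hC hC'
      rw [h Q i (by simp [hN]), sum_congr rfl fun j hj => h P j (hN' hj)]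
      exact nonManipulability_RP hN' hi hN hS hp hC hC'
end

section
/- An indicator R satisfies composition, nullity, and strong symmetry if and only if R is the subscriber-uniform indicator, i.e., R_i(N,S,p,C) = Σ_{s∈S with i∈N_s} p_s/|N_s| for every platform (N,S,p,C) and every i ∈ N, where N_s = {j ∈ N : C_{js} > 0}. -/
open Finset

/-- The platform `P` with its population restricted to the subscribers in `T`. -/
def Platform.restrict (P : Platform) (T : Finset ℕ) (hT : T.Nonempty) (hTS : T ⊆ P.S) :
    Platform where
  N := P.N
  S := T
  p := P.p
  C := P.C
  card_N := P.card_N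
  S_nonempty := hT
  p_pos s hs := P.p_pos s (hTS hs)
  C_nonneg := P.C_nonneg
  col_pos s hs := P.col_pos s (hTS hs)

theorem mem_Ns {P : Platform} {s i : ℕ} : i ∈ Ns P s ↔ i ∈ P.N ∧ 0 < P.C i s :=
  Finset.mem_filter

theorem Ns_nonempty (P : Platform) {s : ℕ} (hs : s ∈ P.S) : (Ns P s).Nonempty := by
  obtain ⟨i, hi, hpos⟩ := Finset.exists_lt_of_sum_lt
    (show ∑ _i ∈ P.N, (0 : ℝ) < ∑ i ∈ P.N, P.C i s by simpa using P.col_pos s hs)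
  exact ⟨i, mem_Ns.2 ⟨hi, hpos⟩⟩

theorem RSU_eq_sum_ite (P : Platform) (i : ℕ) :
    RSU P i = ∑ s ∈ P.S, if i ∈ Ns P s then P.p s / ((Ns P s).card : ℝ) else 0 :=
  Finset.sum_filter _ _

theorem Ns_congr {P Q : Platform} {s : ℕ} (hN : Q.N = P.N)
    (hC : ∀ i ∈ P.N, Q.C i s = P.C i s) : Ns Q s = Ns P s := by
  ext i
  rw [mem_Ns, mem_Ns, hN]
  exact and_congr_right fun hi => by rw [hC i hi]

theorem RSU_composition : CompositionAxiom RSU := by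
  intro P P' Q hN' hN hdisj hS hp hp' hC hC' i _
  rw [RSU_eq_sum_ite, RSU_eq_sum_ite, RSU_eq_sum_ite, hS, Finset.sum_union hdisj]
  congr 1
  · refine Finset.sum_congr rfl fun s hs => ?_
    rw [Ns_congr hN fun j hj => hC j hj s hs, hp s hs]
  · refine Finset.sum_congr rfl fun s hs => ?_
    rw [Ns_congr (hN.trans hN'.symm) fun j hj => hC' j (hN' ▸ hj) s hs, hp' s hs]

theorem RSU_nullity : Nullity RSU := by
  intro P i _ h
  rw [RSU_eq_sum_ite]
  refine Finset.sum_eq_zero fun s hs => if_neg fun hi => ?_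
  exact (mem_Ns.1 hi).2.ne' (h s hs)

theorem RSU_strongSymmetry : StrongSymmetry RSU := by
  intro P i hi j hj h
  rw [RSU_eq_sum_ite, RSU_eq_sum_ite]
  refine Finset.sum_congr rfl fun s hs => ?_
  have hiff : i ∈ Ns P s ↔ j ∈ Ns P s := by simp [mem_Ns, hi, hj, h s hs]
  simp only [hiff]

/-- On a platform with a single subscriber, nullity and strong symmetry determine an indicator. -/
theorem eq_RSU_of_singleton {R : Platform → ℕ → ℝ} (hR : IsIndicator R) (hnull : Nullity R)
    (hsymm : StrongSymmetry R) {P : Platform} {a : ℕ} (hS : P.S = {a}) {i : ℕ} (hi : i ∈ P.N) :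
    R P i = RSU P i := by
  have hzero : ∀ j ∈ P.N, j ∉ Ns P a → R P j = 0 := by
    intro j hj hja
    refine hnull P j hj fun s hs => ?_
    obtain rfl : s = a := by simpa [hS] using hs
    exact le_antisymm (not_lt.1 fun hpos => hja (mem_Ns.2 ⟨hj, hpos⟩)) (P.C_nonneg j s)
  rw [RSU_eq_sum_ite, hS, Finset.sum_singleton]
  split_ifs with hia
  · have hconst : ∀ j ∈ Ns P a, R P j = R P i := by
      intro j hj
      refine hsymm P j (mem_Ns.1 hj).1 i hi fun s hs => ?_
      obtain rfl : s = a := by simpa [hS] using hs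
      simp [(mem_Ns.1 hj).2, (mem_Ns.1 hia).2]
    have hsum : ((Ns P a).card : ℝ) * R P i = P.p a := by
      calc ((Ns P a).card : ℝ) * R P i = ∑ j ∈ Ns P a, R P j := by
            rw [Finset.sum_congr rfl hconst, Finset.sum_const, nsmul_eq_mul]
        _ = ∑ j ∈ P.N, R P j := Finset.sum_subset (Finset.filter_subset _ _) hzero
        _ = P.p a := by rw [(hR P).2, success, hS, Finset.sum_singleton]
    have hcard : ((Ns P a).card : ℝ) ≠ 0 :=
      Nat.cast_ne_zero.2 (Finset.card_ne_zero_of_mem hia)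
    rw [eq_div_iff hcard, mul_comm, hsum]
  · exact hzero i hi hia

/-- Two indicators satisfying composition that agree on single-subscriber platforms are equal. -/
theorem CompositionAxiom.eq_of_eq_on_singleton {R R' : Platform → ℕ → ℝ}
    (hR : CompositionAxiom R) (hR' : CompositionAxiom R')
    (h : ∀ (P : Platform) (a : ℕ), P.S = {a} → ∀ i ∈ P.N, R P i = R' P i)
    (P : Platform) {i : ℕ} (hi : i ∈ P.N) : R P i = R' P i := by
  suffices H : ∀ (T : Finset ℕ) (hT : T.Nonempty) (hTS : T ⊆ P.S),
      R (P.restrict T hT hTS) i = R' (P.restrict T hT hTS) i from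
    H P.S P.S_nonempty (Finset.Subset.refl _)
  intro T hT
  induction hT using Finset.Nonempty.cons_induction with
  | singleton a => exact fun _ => h _ a rfl i hi
  | cons a T haT hT ih =>
    intro hTS
    have ha : {a} ⊆ P.S := fun s hs => hTS (by simp_all)
    have hT' : T ⊆ P.S := fun s hs => hTS (Finset.mem_cons_of_mem hs)
    have key : ∀ {F : Platform → ℕ → ℝ}, CompositionAxiom F →
        F (P.restrict (Finset.cons a T haT) (Finset.cons_nonempty haT) hTS) i =
          F (P.restrict {a} (Finset.singleton_nonempty a) ha) i + F (P.restrict T hT hT') i :=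
      fun hF => hF (P.restrict {a} _ ha) (P.restrict T hT hT') (P.restrict _ _ hTS) rfl rfl
        (Finset.disjoint_singleton_left.2 haT)
        (Finset.cons_eq_insert a T haT) (fun _ _ => rfl) (fun _ _ => rfl)
        (fun _ _ _ _ => rfl) (fun _ _ _ _ => rfl) i hi
    rw [key hR, key hR', ih hT', h (P.restrict {a} _ ha) a rfl i hi]

/-- An indicator satisfies composition, nullity, and strong symmetry if and only if it is the
subscriber-uniform indicator. -/
theorem subscriberUniform_characterization (R : Platform → ℕ → ℝ) (hR : IsIndicator R) :
    (CompositionAxiom R ∧ Nullity R ∧ StrongSymmetry R) ↔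
      (∀ P : Platform, ∀ i ∈ P.N, R P i = RSU P i) := by
  constructor
  · rintro ⟨hcomp, hnull, hsymm⟩ P i hi
    exact hcomp.eq_of_eq_on_singleton RSU_composition
      (fun Q a hS j hj => eq_RSU_of_singleton hR hnull hsymm hS hj) P hi
  · intro h
    refine ⟨?_, ?_, ?_⟩
    · intro P P' Q hN' hN hdisj hS hp hp' hC hC' i hi
      rw [h Q i (hN ▸ hi), h P i hi, h P' i (hN' ▸ hi)]
      exact RSU_composition P P' Q hN' hN hdisj hS hp hp' hC hC' i hi
    · intro P i hi hzero
      rw [h P i hi]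
      exact RSU_nullity P i hi hzero
    · intro P i hi j hj hiff
      rw [h P i hi, h P j hj]
      exact RSU_strongSymmetry P i hi j hj hiff
end
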